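/- Suppose the meridian surface M² has pointwise 1-type Gauss map, i.e. ΔG = λ(G + C) on I × J for a smooth nowhere-zero function λ and a constant bivector C ∈ Λ²ℝ⁴. Then at every (u,v) ∈ I × J the following hold: κ_α(u) κ'(v) = 0; κ(v) (f κ_α)'(u) = 0; and λ f² g' = g'(1 + (f κ_α)² + κ²) − f f' (f κ_α)'. -/

import Mathlib

open Matrix

noncomputable section

/-- The embedding of `ℝ³ = span{e₁,e₂,e₃}` into `ℝ⁴`. -/
def emb (p : Fin 3 → ℝ) : Fin 4 → ℝ := ![p 0, p 1, p 2, 0]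

/-- The fourth standard basis vector `e₄` of `ℝ⁴`. -/
def e4 : Fin 4 → ℝ := ![0, 0, 0, 1]

/-- Model of the bivector `a ∧ b ∈ Λ²ℝ⁴` as the antisymmetric matrix `aᵢbⱼ − aⱼbᵢ`. -/
def wedge (a b : Fin 4 → ℝ) : Fin 4 → Fin 4 → ℝ := fun i j => a i * b j - a j * b i

/-- The tangent `t = r'` of the spherical curve `r`. -/
def sphT (r : ℝ → Fin 3 → ℝ) : ℝ → Fin 3 → ℝ := deriv r

/-- The normal `n = r × t` of the spherical curve `r`. -/
def sphN (r : ℝ → Fin 3 → ℝ) (v : ℝ) : Fin 3 → ℝ := crossProduct (r v) (deriv r v)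

/-- The spherical curvature `κ = ⟨t', n⟩` of the spherical curve `r`. -/
def sphCurv (r : ℝ → Fin 3 → ℝ) (v : ℝ) : ℝ := deriv (deriv r) v ⬝ᵥ sphN r v

/-- The curvature `κ_α = f′g″ − g′f″` of the meridian curve `α = (f, g)`. -/
def merCurv (f g : ℝ → ℝ) (u : ℝ) : ℝ :=
  deriv f u * deriv (deriv g) u - deriv g u * deriv (deriv f) u

/-- The parametrization `z(u,v) = f(u) r(v) + g(u) e₄` of the meridian surface `M²`. -/
def mz (f g : ℝ → ℝ) (r : ℝ → Fin 3 → ℝ) (u v : ℝ) : Fin 4 → ℝ :=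
  f u • emb (r v) + g u • e4

/-- The tangent frame vector `x = ∂z/∂u = f′ r + g′ e₄`. -/
def mx (f g : ℝ → ℝ) (r : ℝ → Fin 3 → ℝ) (u v : ℝ) : Fin 4 → ℝ :=
  deriv f u • emb (r v) + deriv g u • e4

/-- The tangent frame vector `y = (1/f) ∂z/∂v = t`. -/
def my (r : ℝ → Fin 3 → ℝ) (v : ℝ) : Fin 4 → ℝ := emb (deriv r v)

/-- The normal frame vector `n₁ = n`. -/
def mn1 (r : ℝ → Fin 3 → ℝ) (v : ℝ) : Fin 4 → ℝ := emb (sphN r v)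

/-- The normal frame vector `n₂ = −g′ r + f′ e₄`. -/
def mn2 (f g : ℝ → ℝ) (r : ℝ → Fin 3 → ℝ) (u v : ℝ) : Fin 4 → ℝ :=
  (-(deriv g u)) • emb (r v) + deriv f u • e4

/-- The Gauss map `G = x ∧ y` of the meridian surface, with values in `Λ²ℝ⁴`. -/
def gaussG (f g : ℝ → ℝ) (r : ℝ → Fin 3 → ℝ) (u v : ℝ) : Fin 4 → Fin 4 → ℝ :=
  wedge (mx f g r u v) (my r v)

/-- The Laplacian `Δφ = −(∂²φ/∂u² + (1/f²) ∂²φ/∂v² + (f′/f) ∂φ/∂u)` of the meridian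
surface, acting on `Λ²ℝ⁴`-valued functions. -/
def surfLap (f : ℝ → ℝ) (φ : ℝ → ℝ → Fin 4 → Fin 4 → ℝ) (u v : ℝ) : Fin 4 → Fin 4 → ℝ :=
  -(deriv (deriv (fun s => φ s v)) u + (1 / f u ^ 2) • deriv (deriv (fun s => φ u s)) v
    + (deriv f u / f u) • deriv (fun s => φ s v) u)

/-- `h(x,x)`: the normal component (w.r.t. `{n₁, n₂}`) of `∇′ₓx = ∂x/∂u`. -/
def hxx (f g : ℝ → ℝ) (r : ℝ → Fin 3 → ℝ) (u v : ℝ) : Fin 4 → ℝ :=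
  (deriv (fun s => mx f g r s v) u ⬝ᵥ mn1 r v) • mn1 r v
    + (deriv (fun s => mx f g r s v) u ⬝ᵥ mn2 f g r u v) • mn2 f g r u v

/-- `h(x,y)`: the normal component (w.r.t. `{n₁, n₂}`) of `∇′_y x = (1/f) ∂x/∂v`. -/
def hxy (f g : ℝ → ℝ) (r : ℝ → Fin 3 → ℝ) (u v : ℝ) : Fin 4 → ℝ :=
  (((1 / f u) • deriv (fun s => mx f g r u s) v) ⬝ᵥ mn1 r v) • mn1 r v
    + (((1 / f u) • deriv (fun s => mx f g r u s) v) ⬝ᵥ mn2 f g r u v) • mn2 f g r u v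

/-- `h(y,y)`: the normal component (w.r.t. `{n₁, n₂}`) of `∇′_y y = (1/f) ∂y/∂v`. -/
def hyy (f g : ℝ → ℝ) (r : ℝ → Fin 3 → ℝ) (u v : ℝ) : Fin 4 → ℝ :=
  (((1 / f u) • deriv (my r) v) ⬝ᵥ mn1 r v) • mn1 r v
    + (((1 / f u) • deriv (my r) v) ⬝ᵥ mn2 f g r u v) • mn2 f g r u v

theorem ContDiffOn.deriv_top_of_isOpen {E : Type*} [NormedAddCommGroup E] [NormedSpace ℝ E]
    {F : ℝ → E} {S : Set ℝ} (hF : ContDiffOn ℝ (⊤ : ℕ∞) F S) (hS : IsOpen S) :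
    ContDiffOn ℝ (⊤ : ℕ∞) (deriv F) S :=
  hF.deriv_of_isOpen hS (by simp)

theorem ContDiffOn.hasDerivAt_of_isOpen {E : Type*} [NormedAddCommGroup E] [NormedSpace ℝ E]
    {F : ℝ → E} {S : Set ℝ} (hF : ContDiffOn ℝ (⊤ : ℕ∞) F S) (hS : IsOpen S)
    {s : ℝ} (hs : s ∈ S) : HasDerivAt F (deriv F s) s :=
  ((hF.differentiableOn (by simp)).differentiableAt (hS.mem_nhds hs)).hasDerivAt

/-- If `F` is constant on an open set, every derivative of `F` there vanishes. -/
theorem HasDerivAt.eq_zero_of_eqOn_const {F : ℝ → ℝ} {S : Set ℝ} (hS : IsOpen S) {c F' s : ℝ}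
    (hF : ∀ x ∈ S, F x = c) (hs : s ∈ S) (h : HasDerivAt F F' s) : F' = 0 := by
  have hc : F =ᶠ[nhds s] fun _ => c := by
    filter_upwards [hS.mem_nhds hs] with x hx using hF x hx
  exact h.unique ((hasDerivAt_const s c).congr_of_eventuallyEq hc)

theorem HasDerivAt.dotProduct {m : Type*} [Fintype m] {a b : ℝ → m → ℝ} {a' b' : m → ℝ} {s : ℝ}
    (ha : HasDerivAt a a' s) (hb : HasDerivAt b b' s) :
    HasDerivAt (fun x => a x ⬝ᵥ b x) (a' ⬝ᵥ b s + a s ⬝ᵥ b') s := by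
  rw [hasDerivAt_pi] at ha hb
  simp only [_root_.dotProduct, ← Finset.sum_add_distrib]
  exact HasDerivAt.fun_sum fun i _ => (ha i).mul (hb i)

theorem HasDerivAt.crossProduct {a b : ℝ → Fin 3 → ℝ} {a' b' : Fin 3 → ℝ} {s : ℝ}
    (ha : HasDerivAt a a' s) (hb : HasDerivAt b b' s) :
    HasDerivAt (fun x => _root_.crossProduct (a x) (b x))
      (_root_.crossProduct a' (b s) + _root_.crossProduct (a s) b') s := by
  rw [hasDerivAt_pi] at ha hb ⊢
  intro i
  fin_cases i
  · refine (((ha 1).mul (hb 2)).sub ((ha 2).mul (hb 1))).congr_deriv ?_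
    simp [cross_apply]; ring
  · refine (((ha 2).mul (hb 0)).sub ((ha 0).mul (hb 2))).congr_deriv ?_
    simp [cross_apply]; ring
  · refine (((ha 0).mul (hb 1)).sub ((ha 1).mul (hb 0))).congr_deriv ?_
    simp [cross_apply]; ring

theorem HasDerivAt.emb {a : ℝ → Fin 3 → ℝ} {a' : Fin 3 → ℝ} {s : ℝ} (ha : HasDerivAt a a' s) :
    HasDerivAt (fun x => _root_.emb (a x)) (_root_.emb a') s := by
  rw [hasDerivAt_pi] at ha ⊢
  intro i
  fin_cases i
  · exact ha 0
  · exact ha 1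
  · exact ha 2
  · exact hasDerivAt_const s 0

theorem HasDerivAt.wedge {a b : ℝ → Fin 4 → ℝ} {a' b' : Fin 4 → ℝ} {s : ℝ}
    (ha : HasDerivAt a a' s) (hb : HasDerivAt b b' s) :
    HasDerivAt (fun x => _root_.wedge (a x) (b x))
      (_root_.wedge a' (b s) + _root_.wedge (a s) b') s := by
  rw [hasDerivAt_pi] at ha hb
  rw [hasDerivAt_pi]; intro i
  rw [hasDerivAt_pi]; intro j
  refine (((ha i).mul (hb j)).sub ((ha j).mul (hb i))).congr_deriv ?_
  simp [_root_.wedge]; ring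

/-- The value of the bilinear form with matrix `W` on `(a, b)`. -/
def bivecEval (W : Fin 4 → Fin 4 → ℝ) (a b : Fin 4 → ℝ) : ℝ := ∑ i, ∑ j, W i j * (a i * b j)

theorem bivecEval_add (W W' : Fin 4 → Fin 4 → ℝ) (a b : Fin 4 → ℝ) :
    bivecEval (W + W') a b = bivecEval W a b + bivecEval W' a b := by
  simp [bivecEval, add_mul, Finset.sum_add_distrib]

theorem bivecEval_smul (c : ℝ) (W : Fin 4 → Fin 4 → ℝ) (a b : Fin 4 → ℝ) :
    bivecEval (c • W) a b = c * bivecEval W a b := by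
  simp [bivecEval, mul_assoc, Finset.mul_sum]

theorem bivecEval_wedge (p q a b : Fin 4 → ℝ) :
    bivecEval (wedge p q) a b = (p ⬝ᵥ a) * (q ⬝ᵥ b) - (p ⬝ᵥ b) * (q ⬝ᵥ a) := by
  simp [bivecEval, wedge, dotProduct, Fin.sum_univ_four]; ring

theorem HasDerivAt.bivecEval (W : Fin 4 → Fin 4 → ℝ) {a b : ℝ → Fin 4 → ℝ} {a' b' : Fin 4 → ℝ}
    {s : ℝ} (ha : HasDerivAt a a' s) (hb : HasDerivAt b b' s) :
    HasDerivAt (fun x => _root_.bivecEval W (a x) (b x))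
      (_root_.bivecEval W a' (b s) + _root_.bivecEval W (a s) b') s := by
  rw [hasDerivAt_pi] at ha hb
  simp only [_root_.bivecEval, ← Finset.sum_add_distrib, ← mul_add]
  exact HasDerivAt.fun_sum fun i _ => HasDerivAt.fun_sum fun j _ =>
    ((ha i).mul (hb j)).const_mul _

theorem bivecEval_emb_right_combo (W : Fin 4 → Fin 4 → ℝ) (a : Fin 4 → ℝ) (p q : Fin 3 → ℝ)
    (k : ℝ) : bivecEval W a (emb (-p + k • q)) =
      -bivecEval W a (emb p) + k * bivecEval W a (emb q) := by
  simp [bivecEval, emb, Fin.sum_univ_four]; ring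

theorem bivecEval_emb_smul_right (W : Fin 4 → Fin 4 → ℝ) (a : Fin 4 → ℝ) (p : Fin 3 → ℝ) (k : ℝ) :
    bivecEval W a (emb (k • p)) = k * bivecEval W a (emb p) := by
  simp [bivecEval, emb, Fin.sum_univ_four]; ring

theorem emb_dotProduct_emb (p q : Fin 3 → ℝ) : emb p ⬝ᵥ emb q = p ⬝ᵥ q := by
  simp [emb, dotProduct, Fin.sum_univ_four, Fin.sum_univ_three]

theorem emb_dotProduct_e4 (p : Fin 3 → ℝ) : emb p ⬝ᵥ e4 = 0 := by
  simp [emb, e4, dotProduct, Fin.sum_univ_four]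

theorem e4_dotProduct_emb (p : Fin 3 → ℝ) : e4 ⬝ᵥ emb p = 0 := by
  simp [emb, e4, dotProduct, Fin.sum_univ_four]

theorem e4_dotProduct_e4 : e4 ⬝ᵥ e4 = 1 := by
  simp [e4, dotProduct, Fin.sum_univ_four]

/-- Expansion of a vector of `ℝ³` in the orthonormal frame `p, q, p × q`. -/
theorem eq_orthonormal_cross_expansion {p q w : Fin 3 → ℝ} (hpp : p ⬝ᵥ p = 1) (hqq : q ⬝ᵥ q = 1)
    (hpq : p ⬝ᵥ q = 0) :
    w = (w ⬝ᵥ p) • p + (w ⬝ᵥ q) • q + (w ⬝ᵥ crossProduct p q) • crossProduct p q := by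
  have hM : (!![p 0, p 1, p 2; q 0, q 1, q 2; p 1 * q 2 - p 2 * q 1, p 2 * q 0 - p 0 * q 2,
      p 0 * q 1 - p 1 * q 0] : Matrix (Fin 3) (Fin 3) ℝ) *
      (!![p 0, p 1, p 2; q 0, q 1, q 2; p 1 * q 2 - p 2 * q 1, p 2 * q 0 - p 0 * q 2,
      p 0 * q 1 - p 1 * q 0] : Matrix (Fin 3) (Fin 3) ℝ)ᵀ = 1 := by
    simp only [dotProduct, Fin.sum_univ_three] at hpp hqq hpq
    ext i j
    fin_cases i <;> fin_cases j <;> simp [Matrix.mul_apply, Fin.sum_univ_three] <;> grind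
  have hM' := mul_eq_one_comm.mp hM
  have hw := congrArg (fun A : Matrix (Fin 3) (Fin 3) ℝ => A *ᵥ w) hM'
  simp only [Matrix.one_mulVec] at hw
  rw [← Matrix.mulVec_mulVec] at hw
  ext i
  have hi := congrFun hw i
  fin_cases i <;>
    simp [Matrix.mulVec, dotProduct, Fin.sum_univ_three, cross_apply] at hi ⊢ <;> linarith

section Sphere

variable {r : ℝ → Fin 3 → ℝ} {J : Set ℝ}

theorem sphere_curve_dot_deriv (hJ : IsOpen J) (hr : ContDiffOn ℝ (⊤ : ℕ∞) r J)
    (hrs : ∀ v ∈ J, r v ⬝ᵥ r v = 1) {v : ℝ} (hv : v ∈ J) : r v ⬝ᵥ deriv r v = 0 := by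
  have h := hr.hasDerivAt_of_isOpen hJ hv
  have h0 := HasDerivAt.eq_zero_of_eqOn_const hJ hrs hv (h.dotProduct h)
  rw [dotProduct_comm (deriv r v)] at h0
  linarith

theorem sphere_curve_hasDerivAt_tangent (hJ : IsOpen J) (hr : ContDiffOn ℝ (⊤ : ℕ∞) r J)
    (hrs : ∀ v ∈ J, r v ⬝ᵥ r v = 1) (hra : ∀ v ∈ J, deriv r v ⬝ᵥ deriv r v = 1)
    {v : ℝ} (hv : v ∈ J) :
    HasDerivAt (deriv r) (-r v + sphCurv r v • sphN r v) v := by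
  have h := hr.hasDerivAt_of_isOpen hJ hv
  have h' := (hr.deriv_top_of_isOpen hJ).hasDerivAt_of_isOpen hJ hv
  have h0 := HasDerivAt.eq_zero_of_eqOn_const hJ hra hv (h'.dotProduct h')
  have h1 := HasDerivAt.eq_zero_of_eqOn_const hJ
    (fun x hx => sphere_curve_dot_deriv hJ hr hrs hx) hv (h.dotProduct h')
  rw [hra v hv, dotProduct_comm] at h1
  rw [dotProduct_comm (deriv r v)] at h0
  have hexp := eq_orthonormal_cross_expansion (w := deriv (deriv r) v) (hrs v hv) (hra v hv)
    (sphere_curve_dot_deriv hJ hr hrs hv)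
  rw [show deriv (deriv r) v ⬝ᵥ r v = -1 by linarith,
    show deriv (deriv r) v ⬝ᵥ deriv r v = 0 by linarith] at hexp
  refine h'.congr_deriv (hexp.trans ?_)
  simp [sphCurv, sphN]

theorem sphere_curve_hasDerivAt_normal (hJ : IsOpen J) (hr : ContDiffOn ℝ (⊤ : ℕ∞) r J)
    (hrs : ∀ v ∈ J, r v ⬝ᵥ r v = 1) (hra : ∀ v ∈ J, deriv r v ⬝ᵥ deriv r v = 1)
    {v : ℝ} (hv : v ∈ J) :
    HasDerivAt (sphN r) (-sphCurv r v • deriv r v) v := by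
  have h := (hr.hasDerivAt_of_isOpen hJ hv).crossProduct
    (sphere_curve_hasDerivAt_tangent hJ hr hrs hra hv)
  refine h.congr_deriv ?_
  have hrt := sphere_curve_dot_deriv hJ hr hrs hv
  have hrr := hrs v hv
  generalize sphCurv r v = k
  simp only [dotProduct, Fin.sum_univ_three] at hrt hrr
  ext i
  fin_cases i <;> simp [sphN, cross_apply, vecHead, vecTail] <;> grind

theorem sphere_curve_hasDerivAt_curvature (hJ : IsOpen J) (hr : ContDiffOn ℝ (⊤ : ℕ∞) r J)
    (hrs : ∀ v ∈ J, r v ⬝ᵥ r v = 1) (hra : ∀ v ∈ J, deriv r v ⬝ᵥ deriv r v = 1)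
    {v : ℝ} (hv : v ∈ J) :
    HasDerivAt (sphCurv r) (deriv (sphCurv r) v) v := by
  have h' := ((hr.deriv_top_of_isOpen hJ).deriv_top_of_isOpen hJ).hasDerivAt_of_isOpen hJ hv
  exact (h'.dotProduct
    (sphere_curve_hasDerivAt_normal hJ hr hrs hra hv)).differentiableAt.hasDerivAt

theorem sphN_dot_self (hJ : IsOpen J) (hr : ContDiffOn ℝ (⊤ : ℕ∞) r J)
    (hrs : ∀ v ∈ J, r v ⬝ᵥ r v = 1) (hra : ∀ v ∈ J, deriv r v ⬝ᵥ deriv r v = 1)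
    {v : ℝ} (hv : v ∈ J) : sphN r v ⬝ᵥ sphN r v = 1 := by
  rw [sphN, cross_dot_cross, hrs v hv, hra v hv, sphere_curve_dot_deriv hJ hr hrs hv]
  simp

/-- The second derivative in `v` of the Gauss map, in terms of the spherical frame. -/
theorem gaussG_deriv_deriv_snd (hJ : IsOpen J) (hr : ContDiffOn ℝ (⊤ : ℕ∞) r J)
    (hrs : ∀ v ∈ J, r v ⬝ᵥ r v = 1) (hra : ∀ v ∈ J, deriv r v ⬝ᵥ deriv r v = 1)
    (f g : ℝ → ℝ) (u : ℝ) {v : ℝ} (hv : v ∈ J) :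
    deriv (deriv (fun s => gaussG f g r u s)) v =
      deriv f u • (deriv (sphCurv r) v • wedge (emb (r v)) (emb (sphN r v))
        + sphCurv r v • wedge (emb (deriv r v)) (emb (sphN r v))
        + (-sphCurv r v ^ 2) • wedge (emb (r v)) (emb (deriv r v)))
      + deriv g u • ((-(1 + sphCurv r v ^ 2)) • wedge e4 (emb (deriv r v))
        + deriv (sphCurv r) v • wedge e4 (emb (sphN r v))) := by
  have hfst : ∀ s ∈ J, deriv (fun s => gaussG f g r u s) s =
      deriv f u • (sphCurv r s • wedge (emb (r s)) (emb (sphN r s)))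
      + deriv g u • (-wedge e4 (emb (r s)) + sphCurv r s • wedge e4 (emb (sphN r s))) := by
    intro s hs
    have h1 := (hr.hasDerivAt_of_isOpen hJ hs).emb
    have h2 := (sphere_curve_hasDerivAt_tangent hJ hr hrs hra hs).emb
    have h := (((h1.const_smul (deriv f u)).add_const (deriv g u • e4)).wedge h2).deriv
    refine Eq.trans h ?_
    ext i j
    fin_cases i <;> fin_cases j <;> simp [wedge, emb, e4] <;> ring
  have hev : deriv (fun s => gaussG f g r u s) =ᶠ[nhds v] fun s =>
      deriv f u • (sphCurv r s • wedge (emb (r s)) (emb (sphN r s)))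
      + deriv g u • (-wedge e4 (emb (r s)) + sphCurv r s • wedge e4 (emb (sphN r s))) := by
    filter_upwards [hJ.mem_nhds hv] with s hs using hfst s hs
  rw [hev.deriv_eq]
  have h1 := (hr.hasDerivAt_of_isOpen hJ hv).emb
  have h3 := (sphere_curve_hasDerivAt_normal hJ hr hrs hra hv).emb
  have hk := sphere_curve_hasDerivAt_curvature hJ hr hrs hra hv
  have he := hasDerivAt_const v e4
  have h := (((hk.smul (h1.wedge h3)).const_smul (deriv f u)).add
    (((he.wedge h1).neg.add (hk.smul (he.wedge h3))).const_smul (deriv g u))).deriv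
  refine Eq.trans h ?_
  ext i j
  fin_cases i <;> fin_cases j <;> simp [wedge, emb, e4] <;> ring

end Sphere

section Meridian

variable {f g : ℝ → ℝ} {I : Set ℝ}

theorem merCurv_frenet (hI : IsOpen I) (hf : ContDiffOn ℝ (⊤ : ℕ∞) f I)
    (hg : ContDiffOn ℝ (⊤ : ℕ∞) g I) (hfg : ∀ u ∈ I, deriv f u ^ 2 + deriv g u ^ 2 = 1)
    {u : ℝ} (hu : u ∈ I) :
    HasDerivAt (deriv f) (-(merCurv f g u * deriv g u)) u ∧
      HasDerivAt (deriv g) (merCurv f g u * deriv f u) u := by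
  have hf' := (hf.deriv_top_of_isOpen hI).hasDerivAt_of_isOpen hI hu
  have hg' := (hg.deriv_top_of_isOpen hI).hasDerivAt_of_isOpen hI hu
  have h0 := HasDerivAt.eq_zero_of_eqOn_const hI hfg hu ((hf'.pow 2).add (hg'.pow 2))
  have h1 := hfg u hu
  simp only [merCurv]
  constructor
  · refine hf'.congr_deriv ?_
    simp at h0
    grind
  · refine hg'.congr_deriv ?_
    simp at h0
    grind

theorem hasDerivAt_merCurv (hI : IsOpen I) (hf : ContDiffOn ℝ (⊤ : ℕ∞) f I)
    (hg : ContDiffOn ℝ (⊤ : ℕ∞) g I) {u : ℝ} (hu : u ∈ I) :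
    HasDerivAt (merCurv f g) (deriv (merCurv f g) u) u := by
  have hf1 := hf.deriv_top_of_isOpen hI
  have hg1 := hg.deriv_top_of_isOpen hI
  have hf2 := (hf1.deriv_top_of_isOpen hI).hasDerivAt_of_isOpen hI hu
  have hg2 := (hg1.deriv_top_of_isOpen hI).hasDerivAt_of_isOpen hI hu
  exact (((hf1.hasDerivAt_of_isOpen hI hu).mul hg2).sub
    ((hg1.hasDerivAt_of_isOpen hI hu).mul hf2)).differentiableAt.hasDerivAt

theorem gaussG_deriv_fst (hI : IsOpen I) (hf : ContDiffOn ℝ (⊤ : ℕ∞) f I)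
    (hg : ContDiffOn ℝ (⊤ : ℕ∞) g I) (hfg : ∀ u ∈ I, deriv f u ^ 2 + deriv g u ^ 2 = 1)
    (r : ℝ → Fin 3 → ℝ) (v : ℝ) {u : ℝ} (hu : u ∈ I) :
    deriv (fun s => gaussG f g r s v) u =
      (-(merCurv f g u * deriv g u)) • wedge (emb (r v)) (emb (deriv r v))
      + (merCurv f g u * deriv f u) • wedge e4 (emb (deriv r v)) := by
  obtain ⟨h1, h2⟩ := merCurv_frenet hI hf hg hfg hu
  have h := (((h1.smul_const (emb (r v))).add (h2.smul_const e4)).wedge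
    (hasDerivAt_const u (emb (deriv r v)))).deriv
  refine Eq.trans h ?_
  ext i j
  fin_cases i <;> fin_cases j <;> simp [wedge, emb, e4] <;> ring

theorem gaussG_deriv_deriv_fst (hI : IsOpen I) (hf : ContDiffOn ℝ (⊤ : ℕ∞) f I)
    (hg : ContDiffOn ℝ (⊤ : ℕ∞) g I) (hfg : ∀ u ∈ I, deriv f u ^ 2 + deriv g u ^ 2 = 1)
    (r : ℝ → Fin 3 → ℝ) (v : ℝ) {u : ℝ} (hu : u ∈ I) :
    deriv (deriv (fun s => gaussG f g r s v)) u =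
      (-(deriv (merCurv f g) u * deriv g u + merCurv f g u ^ 2 * deriv f u)) •
        wedge (emb (r v)) (emb (deriv r v))
      + (deriv (merCurv f g) u * deriv f u - merCurv f g u ^ 2 * deriv g u) •
        wedge e4 (emb (deriv r v)) := by
  have hev : deriv (fun s => gaussG f g r s v) =ᶠ[nhds u] fun s =>
      (-(merCurv f g s * deriv g s)) • wedge (emb (r v)) (emb (deriv r v))
      + (merCurv f g s * deriv f s) • wedge e4 (emb (deriv r v)) := by
    filter_upwards [hI.mem_nhds hu] with s hs using gaussG_deriv_fst hI hf hg hfg r v hs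
  rw [hev.deriv_eq]
  obtain ⟨h1, h2⟩ := merCurv_frenet hI hf hg hfg hu
  have ha := hasDerivAt_merCurv hI hf hg hu
  refine Eq.trans (((ha.mul h2).neg.smul_const _).add ((ha.mul h1).smul_const _)).deriv ?_
  congr 2 <;> ring

end Meridian

/-- The Laplacian of the Gauss map in terms of the spherical frame. -/
theorem surfLap_gaussG {I J : Set ℝ} (hI : IsOpen I) (hJ : IsOpen J)
    {r : ℝ → Fin 3 → ℝ} (hr : ContDiffOn ℝ (⊤ : ℕ∞) r J)
    (hrs : ∀ v ∈ J, r v ⬝ᵥ r v = 1) (hra : ∀ v ∈ J, deriv r v ⬝ᵥ deriv r v = 1)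
    {f g : ℝ → ℝ} (hf : ContDiffOn ℝ (⊤ : ℕ∞) f I) (hg : ContDiffOn ℝ (⊤ : ℕ∞) g I)
    (hfg : ∀ u ∈ I, deriv f u ^ 2 + deriv g u ^ 2 = 1)
    {u v : ℝ} (hu : u ∈ I) (hv : v ∈ J) :
    surfLap f (gaussG f g r) u v =
      (deriv (merCurv f g) u * deriv g u + merCurv f g u ^ 2 * deriv f u
        + deriv f u * sphCurv r v ^ 2 / f u ^ 2
        + deriv f u / f u * (merCurv f g u * deriv g u)) •
          wedge (emb (r v)) (emb (deriv r v))
      + (-(deriv (merCurv f g) u * deriv f u) + merCurv f g u ^ 2 * deriv g u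
        + deriv g u * (1 + sphCurv r v ^ 2) / f u ^ 2
        - deriv f u / f u * (merCurv f g u * deriv f u)) • wedge e4 (emb (deriv r v))
      + (-(deriv f u * deriv (sphCurv r) v / f u ^ 2)) • wedge (emb (r v)) (emb (sphN r v))
      + (-(deriv f u * sphCurv r v / f u ^ 2)) • wedge (emb (deriv r v)) (emb (sphN r v))
      + (-(deriv g u * deriv (sphCurv r) v / f u ^ 2)) • wedge e4 (emb (sphN r v)) := by
  rw [surfLap, gaussG_deriv_deriv_fst hI hf hg hfg r v hu, gaussG_deriv_fst hI hf hg hfg r v hu,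
    gaussG_deriv_deriv_snd hJ hr hrs hra f g u hv]
  module

theorem gaussG_eq (f g : ℝ → ℝ) (r : ℝ → Fin 3 → ℝ) (u v : ℝ) :
    gaussG f g r u v = deriv f u • wedge (emb (r v)) (emb (deriv r v))
      + deriv g u • wedge e4 (emb (deriv r v)) := by
  ext i j
  simp [gaussG, mx, my, wedge]
  ring

/-- If the meridian surface has pointwise 1-type Gauss map,
`ΔG = λ(G + C)` with `λ` smooth and nowhere zero and `C` a constant bivector, then
`κ_α κ′ = 0`, `κ (fκ_α)′ = 0` and `λ f² g′ = g′(1 + (fκ_α)² + κ²) − f f′ (fκ_α)′`. -/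
theorem meridian_surface_pointwise_one_type_necessary_conditions
    (I J : Set ℝ) (hI : IsOpen I) (hIiv : I.OrdConnected) (hIne : I.Nonempty)
    (hJ : IsOpen J) (hJiv : J.OrdConnected) (hJne : J.Nonempty)
    (r : ℝ → Fin 3 → ℝ) (hr : ContDiffOn ℝ (⊤ : ℕ∞) r J)
    (hrs : ∀ v ∈ J, r v ⬝ᵥ r v = 1) (hra : ∀ v ∈ J, deriv r v ⬝ᵥ deriv r v = 1)
    (f g : ℝ → ℝ) (hf : ContDiffOn ℝ (⊤ : ℕ∞) f I) (hg : ContDiffOn ℝ (⊤ : ℕ∞) g I)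
    (hf0 : ∀ u ∈ I, f u ≠ 0) (hfg : ∀ u ∈ I, deriv f u ^ 2 + deriv g u ^ 2 = 1)
    (lam : ℝ → ℝ → ℝ) (hlam : ContDiffOn ℝ (⊤ : ℕ∞) (Function.uncurry lam) (I ×ˢ J))
    (hlam0 : ∀ u ∈ I, ∀ v ∈ J, lam u v ≠ 0)
    (C : Fin 4 → Fin 4 → ℝ) (hCskew : ∀ i j, C i j = -C j i)
    (heq : ∀ u ∈ I, ∀ v ∈ J,
      surfLap f (gaussG f g r) u v = lam u v • (gaussG f g r u v + C)) :
    ∀ u ∈ I, ∀ v ∈ J,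
      merCurv f g u * deriv (sphCurv r) v = 0 ∧
      sphCurv r v * deriv (fun s => f s * merCurv f g s) u = 0 ∧
      lam u v * f u ^ 2 * deriv g u
        = deriv g u * (1 + (f u * merCurv f g u) ^ 2 + sphCurv r v ^ 2)
          - f u * deriv f u * deriv (fun s => f s * merCurv f g s) u := by
  have hdr := fun v hv => (hr.hasDerivAt_of_isOpen hJ (s := v) hv).emb
  have hdt := fun v hv => (sphere_curve_hasDerivAt_tangent hJ hr hrs hra (v := v) hv).emb
  have hdn := fun v hv => (sphere_curve_hasDerivAt_normal hJ hr hrs hra (v := v) hv).emb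
  have hdk := fun v hv => sphere_curve_hasDerivAt_curvature hJ hr hrs hra (v := v) hv
  have hcomp : ∀ u ∈ I, ∀ v ∈ J, ∀ a b : Fin 4 → ℝ,
      bivecEval (surfLap f (gaussG f g r) u v) a b =
        bivecEval (lam u v • (gaussG f g r u v + C)) a b := fun u hu v hv a b => by
    rw [heq u hu v hv]
  have hred : ∀ u ∈ I, ∀ v ∈ J,
      (deriv (merCurv f g) u * deriv g u + merCurv f g u ^ 2 * deriv f u
        + deriv f u * sphCurv r v ^ 2 / f u ^ 2
        + deriv f u / f u * (merCurv f g u * deriv g u)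
          = lam u v * (deriv f u + bivecEval C (emb (r v)) (emb (deriv r v)))) ∧
      (-(deriv (merCurv f g) u * deriv f u) + merCurv f g u ^ 2 * deriv g u
        + deriv g u * (1 + sphCurv r v ^ 2) / f u ^ 2
        - deriv f u / f u * (merCurv f g u * deriv f u)
          = lam u v * (deriv g u + bivecEval C e4 (emb (deriv r v)))) ∧
      (-(deriv f u * deriv (sphCurv r) v / f u ^ 2)
          = lam u v * bivecEval C (emb (r v)) (emb (sphN r v))) ∧
      (-(deriv f u * sphCurv r v / f u ^ 2)
          = lam u v * bivecEval C (emb (deriv r v)) (emb (sphN r v))) ∧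
      (-(deriv g u * deriv (sphCurv r) v / f u ^ 2)
          = lam u v * bivecEval C e4 (emb (sphN r v))) ∧
      0 = lam u v * bivecEval C e4 (emb (r v)) := by
    intro u hu v hv
    have h := And.intro (hcomp u hu v hv (emb (r v)) (emb (deriv r v))) <|
      And.intro (hcomp u hu v hv e4 (emb (deriv r v))) <|
      And.intro (hcomp u hu v hv (emb (r v)) (emb (sphN r v))) <|
      And.intro (hcomp u hu v hv (emb (deriv r v)) (emb (sphN r v))) <|
      And.intro (hcomp u hu v hv e4 (emb (sphN r v))) (hcomp u hu v hv e4 (emb (r v)))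
    have hnn := sphN_dot_self hJ hr hrs hra hv
    have hrt := sphere_curve_dot_deriv hJ hr hrs hv
    have htr : deriv r v ⬝ᵥ r v = 0 := by rw [dotProduct_comm, hrt]
    have hrn : r v ⬝ᵥ sphN r v = 0 := dot_self_cross _ _
    have hnr : sphN r v ⬝ᵥ r v = 0 := by rw [dotProduct_comm, hrn]
    have htn : deriv r v ⬝ᵥ sphN r v = 0 := dot_cross_self _ _
    have hnt : sphN r v ⬝ᵥ deriv r v = 0 := by rw [dotProduct_comm, htn]
    simp only [surfLap_gaussG hI hJ hr hrs hra hf hg hfg hu hv, gaussG_eq, bivecEval_add,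
      bivecEval_smul, bivecEval_wedge, emb_dotProduct_emb, emb_dotProduct_e4, e4_dotProduct_emb,
      e4_dotProduct_e4, hrs v hv, hra v hv, hnn, hrt, htr, hrn, hnr, htn, hnt, mul_zero,
      sub_zero, mul_one, add_zero, zero_add, sub_self] at h
    exact h
  have her : ∀ v ∈ J, bivecEval C e4 (emb (r v)) = 0 := fun v hv => by
    obtain ⟨u, hu⟩ := hIne
    exact (mul_eq_zero.mp (hred u hu v hv).2.2.2.2.2.symm).resolve_left (hlam0 u hu v hv)
  have hbz : ∀ b, bivecEval C 0 b = 0 := fun b => by simp [bivecEval]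
  have het : ∀ v ∈ J, bivecEval C e4 (emb (deriv r v)) = 0 := fun v hv => by
    have h := HasDerivAt.eq_zero_of_eqOn_const hJ her hv
      ((hasDerivAt_const v e4).bivecEval C (hdr v hv))
    simpa [hbz] using h
  have hen : ∀ v ∈ J, sphCurv r v * bivecEval C e4 (emb (sphN r v)) = 0 := fun v hv => by
    have h := HasDerivAt.eq_zero_of_eqOn_const hJ het hv
      ((hasDerivAt_const v e4).bivecEval C (hdt v hv))
    simpa [hbz, bivecEval_emb_right_combo, her v hv] using h
  intro u hu v hv
  have hfa := (hf.hasDerivAt_of_isOpen hI hu).mul (hasDerivAt_merCurv hI hf hg hu)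
  have hfd : deriv (fun s => f s * merCurv f g s) u
      = deriv f u * merCurv f g u + f u * deriv (merCurv f g) u := hfa.deriv
  rw [hfd]
  obtain ⟨e1, e2, e3, e4', e5, -⟩ := hred u hu v hv
  have hu1 := hfg u hu
  have hf00 := hf0 u hu
  have hl := hlam0 u hu v hv
  rw [het v hv] at e2
  obtain ⟨hp, hq⟩ := merCurv_frenet hI hf hg hfg hu
  field_simp at e1 e2 e3 e4' e5
  refine ⟨?_, ?_, ?_⟩
  · have hzero : ∀ s ∈ I, deriv g s * bivecEval C (emb (r v)) (emb (sphN r v))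
        - deriv f s * bivecEval C e4 (emb (sphN r v)) = 0 := fun s hs => by
      obtain ⟨-, -, h3, -, h5, -⟩ := hred s hs v hv
      refine (mul_eq_zero.mp ?_).resolve_left (hlam0 s hs v hv)
      linear_combination deriv f s * h5 - deriv g s * h3
    have h := HasDerivAt.eq_zero_of_eqOn_const hI hzero hu
      ((hq.mul_const _).sub (hp.mul_const _))
    linear_combination (-merCurv f g u * deriv f u) * e3 - (merCurv f g u * deriv g u) * e5
      - (lam u v * f u ^ 2) * h - merCurv f g u * deriv (sphCurv r) v * hu1
  · by_cases hg0 : deriv g u = 0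
    · rw [hg0] at e2 hu1
      have hp0 : deriv f u ≠ 0 := fun h => by simp [h] at hu1
      refine mul_eq_zero_of_right _ ((mul_eq_zero.mp ?_).resolve_left (mul_ne_zero hf00 hp0))
      linear_combination -e2
    · have hkk : ∀ s ∈ J, sphCurv r s * bivecEval C (emb (r s)) (emb (sphN r s)) = 0 := by
        intro s hs
        obtain ⟨-, -, h3, -, h5, -⟩ := hred u hu s hs
        have hkk' : sphCurv r s * deriv (sphCurv r) s = 0 := by
          field_simp at h5
          refine (mul_eq_zero.mp ?_).resolve_left hg0
          linear_combination (-sphCurv r s) * h5 - lam u s * f u ^ 2 * hen s hs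
        refine (mul_eq_zero.mp ?_).resolve_left (hlam0 u hu s hs)
        linear_combination (-sphCurv r s) * h3 - deriv f u / f u ^ 2 * hkk'
      have h := HasDerivAt.eq_zero_of_eqOn_const hJ hkk hv
        ((hdk v hv).mul ((hdr v hv).bivecEval C (hdn v hv)))
      rw [bivecEval_emb_smul_right] at h
      by_cases hk : sphCurv r v = 0
      · rw [hk, zero_mul]
      · rw [(mul_eq_zero.mp (hkk v hv)).resolve_left hk, mul_zero, zero_add] at h
        have h' := (mul_eq_zero.mp h).resolve_left hk
        have hpC : deriv f u + lam u v * f u ^ 2 * bivecEval C (emb (r v)) (emb (deriv r v))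
            = 0 := by
          refine (mul_eq_zero.mp ?_).resolve_left hk
          linear_combination -e4' - lam u v * f u ^ 2 * h'
        refine mul_eq_zero_of_right _ ((mul_eq_zero.mp ?_).resolve_left hf00)
        linear_combination deriv g u * e1 - deriv f u * e2 + deriv g u * hpC
          - f u * (deriv f u * merCurv f g u + f u * deriv (merCurv f g) u) * hu1
  · linear_combination -e2
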